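/- arXiv:2107.11825 — 2 statements merged into one kernel-verified Lean document; each statement's English description precedes it below -/
import Mathlib

section
/- Let K be a subfield of ℝ and f ∈ K[t] a univariate polynomial. Then f is non-negative on ℝ if and only if there exist a positive integer s, positive elements c₁,…,c_s ∈ K and polynomials g₁,…,g_s ∈ K[t] such that f = c₁g₁² + ⋯ + c_s g_s². -/
open Polynomial

namespace LP

/-- weighted sums of squares -/
noncomputable def WS (K : Subfield ℝ) : AddSubmonoid K[X] :=
  AddSubmonoid.closure {f | ∃ (c : K) (g : K[X]), 0 ≤ (c : ℝ) ∧ f = C c * g ^ 2}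

lemma WS_mem {K : Subfield ℝ} (c : K) (g : K[X]) (h : 0 ≤ (c : ℝ)) : C c * g ^ 2 ∈ WS K :=
  AddSubmonoid.subset_closure ⟨c, g, h, rfl⟩

lemma WS_sq_mul {K : Subfield ℝ} (p : K[X]) {f : K[X]} (hf : f ∈ WS K) : p ^ 2 * f ∈ WS K := by
  induction hf using AddSubmonoid.closure_induction with
  | mem x h =>
    obtain ⟨c, g, h, rfl⟩ := h
    have := WS_mem c (p * g) h
    convert this using 1
    ring
  | zero => simp
  | add x y _ _ hx hy => rw [mul_add]; exact add_mem hx hy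

lemma WS_out {K : Subfield ℝ} {f : K[X]} (hf : f ∈ WS K) :
    ∃ (s : ℕ), 0 < s ∧ ∃ (c : Fin s → K) (g : Fin s → Polynomial K),
      (∀ j, 0 < (c j : ℝ)) ∧ f = ∑ j, Polynomial.C (c j) * (g j) ^ 2 := by
  induction hf using AddSubmonoid.closure_induction with
  | mem x h =>
    obtain ⟨c, g, h, rfl⟩ := h
    rcases h.eq_or_lt with h | h
    · have : c = 0 := by ext; simpa using h.symm
      exact ⟨1, one_pos, fun _ => 1, fun _ => 0, by simp, by simp [this]⟩
    · exact ⟨1, one_pos, fun _ => c, fun _ => g, by simpa using h, by simp⟩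
  | zero => exact ⟨1, one_pos, fun _ => 1, fun _ => 0, by simp, by simp⟩
  | add x y _ _ hx hy =>
    obtain ⟨s, hs, c, g, hc, rfl⟩ := hx
    obtain ⟨t, ht, c', g', hc', rfl⟩ := hy
    refine ⟨s + t, by omega, Fin.append c c', Fin.append g g', ?_, ?_⟩
    · intro j
      refine Fin.addCases (fun i => ?_) (fun i => ?_) j
      · simpa using hc i
      · simpa using hc' i
    · simp [Fin.sum_univ_add]

lemma nonneg_of_sq_mul {p h : ℝ[X]} (hp : p ≠ 0) (H : ∀ x, 0 ≤ (p ^ 2 * h).eval x) (x : ℝ) :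
    0 ≤ h.eval x := by
  have hd : Dense {x : ℝ | p.IsRoot x}ᶜ :=
    Set.Countable.dense_compl ℝ (Polynomial.finite_setOfPred_isRoot hp).countable
  have hc : IsClosed {x : ℝ | 0 ≤ h.eval x} := isClosed_le continuous_const h.continuous
  have hsub : {x : ℝ | p.IsRoot x}ᶜ ⊆ {x : ℝ | 0 ≤ h.eval x} := by
    intro y hy
    have h1 := H y
    have h2 : p.eval y ≠ 0 := hy
    simp only [eval_mul, eval_pow] at h1
    exact nonneg_of_mul_nonneg_right h1 (by positivity)
  have := hc.closure_subset_iff.2 hsub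
  rw [hd.closure_eq] at this
  exact this (Set.mem_univ x)

lemma deriv_root {f : ℝ[X]} (hf : ∀ x, 0 ≤ f.eval x) {a : ℝ} (ha : f.eval a = 0) :
    (derivative f).eval a = 0 := by
  have : IsLocalMin (fun x => f.eval x) a :=
    Filter.Eventually.of_forall fun x => by simpa [ha] using hf x
  simpa using this.deriv_eq_zero

lemma real_root {f : ℝ[X]} (hf : ∀ x, 0 ≤ f.eval x) {a : ℝ} (ha : f.eval a = 0) :
    ∃ h : ℝ[X], f = (X - C a) ^ 2 * h ∧ ∀ x, 0 ≤ h.eval x := by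
  by_cases h0 : f = 0
  · exact ⟨0, by simp [h0], by simp⟩
  have h1 := (one_lt_rootMultiplicity_iff_isRoot h0).2 ⟨ha, deriv_root hf ha⟩
  obtain ⟨h, rfl⟩ := (le_rootMultiplicity_iff h0).1 h1
  exact ⟨h, rfl, nonneg_of_sq_mul (X_sub_C_ne_zero a) hf⟩

lemma exists_min {f : ℝ[X]} (hf : ∀ x, 0 ≤ f.eval x) :
    ∃ a, ∀ x, f.eval a ≤ f.eval x := by
  by_cases hd : 0 < f.degree
  · have := tendsto_norm_atTop f hd (l := Filter.cocompact ℝ) (z := id)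
      (tendsto_norm_cocompact_atTop)
    refine Continuous.exists_forall_le f.continuous ?_
    refine this.congr fun x => ?_
    simp [abs_of_nonneg (hf x)]
  · rw [eq_C_of_degree_le_zero (not_lt.1 hd)]
    simp

lemma decomp {f : ℝ[X]} (hf : ∀ x, 0 ≤ f.eval x) :
    ∃ (m a : ℝ) (h : ℝ[X]), 0 ≤ m ∧ f = C m + (X - C a) ^ 2 * h ∧ ∀ x, 0 ≤ h.eval x := by
  obtain ⟨a, ha⟩ := exists_min hf
  obtain ⟨h, h1, h2⟩ := real_root (f := f - C (f.eval a)) (a := a)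
    (fun x => by simpa using ha x) (by simp)
  exact ⟨f.eval a, a, h, hf a, by rw [← h1]; ring, h2⟩

lemma natDegree_sq_mul (a : ℝ) {h : ℝ[X]} (h0 : h ≠ 0) :
    ((X - C a) ^ 2 * h).natDegree = 2 + h.natDegree := by
  rw [natDegree_mul (pow_ne_zero _ (X_sub_C_ne_zero a)) h0]; simp

lemma even_pos : ∀ (n : ℕ) (f : ℝ[X]), f.natDegree = n → f ≠ 0 → (∀ x, 0 ≤ f.eval x) →
    Even n ∧ 0 < f.leadingCoeff := by
  intro n
  induction n using Nat.strong_induction_on with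
  | _ n ih =>
  intro f hn h0 hf
  obtain ⟨m, a, h, hm, hfe, hh⟩ := decomp hf
  by_cases hh0 : h = 0
  · subst hh0
    simp only [mul_zero, add_zero] at hfe
    subst hfe
    have : m ≠ 0 := by simpa using h0
    simp only [natDegree_C] at hn
    subst hn
    simpa using lt_of_le_of_ne hm this.symm
  · have hd := natDegree_sq_mul a hh0
    have hlt : (C m : ℝ[X]).natDegree < ((X - C a) ^ 2 * h).natDegree := by
      rw [hd]; simp
    have h1 : f.natDegree = 2 + h.natDegree := by
      rw [hfe, natDegree_add_eq_right_of_natDegree_lt hlt, hd]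
    have h2 : f.leadingCoeff = h.leadingCoeff := by
      rw [hfe, leadingCoeff_add_of_degree_lt (degree_lt_degree hlt)]; simp
    obtain ⟨h3, h4⟩ := ih _ (by omega) h rfl hh0 hh
    rw [h2, ← hn, h1]
    exact ⟨by simpa [Nat.even_add] using h3, h4⟩

/-- real sums of squares with bounded degree -/
noncomputable def RS (d : ℕ) : AddSubmonoid ℝ[X] :=
  AddSubmonoid.closure {f | ∃ g : ℝ[X], g.natDegree ≤ d ∧ f = g ^ 2}

lemma RS_mul (a : ℝ) (d : ℕ) {f : ℝ[X]} (hf : f ∈ RS d) : (X - C a) ^ 2 * f ∈ RS (d + 1) := by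
  induction hf using AddSubmonoid.closure_induction with
  | mem x h =>
    obtain ⟨g, h, rfl⟩ := h
    refine AddSubmonoid.subset_closure ⟨(X - C a) * g, ?_, by ring⟩
    refine natDegree_mul_le.trans ?_
    simp; omega
  | zero => simp
  | add x y _ _ hx hy => rw [mul_add]; exact add_mem hx hy

lemma RS_const (d : ℕ) {m : ℝ} (hm : 0 ≤ m) : C m ∈ RS d :=
  AddSubmonoid.subset_closure ⟨C (√m), by simp, by rw [← C_pow, Real.sq_sqrt hm]⟩

lemma real_sos (d : ℕ) : ∀ f : ℝ[X], f.natDegree ≤ 2 * d → (∀ x, 0 ≤ f.eval x) → f ∈ RS d := by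
  induction d with
  | zero =>
    intro f hd hf
    rw [eq_C_of_natDegree_le_zero (p := f) (by simpa using hd)] at hf ⊢
    exact RS_const 0 (by simpa using hf 0)
  | succ d ih =>
    intro f hd hf
    obtain ⟨m, a, h, hm, hfe, hh⟩ := decomp hf
    by_cases hh0 : h = 0
    · rw [hfe, hh0]; simpa using RS_const _ hm
    rw [hfe]
    refine add_mem (RS_const _ hm) (RS_mul a d (ih h ?_ hh))
    have hd' := natDegree_sq_mul a hh0
    have hlt : (C m : ℝ[X]).natDegree < ((X - C a) ^ 2 * h).natDegree := by
      rw [hd']; simp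
    rw [hfe, natDegree_add_eq_right_of_natDegree_lt hlt, hd'] at hd
    omega

lemma approx_sq (K : Subfield ℝ) (d : ℕ) (p : ℝ[X]) (hp : p.natDegree ≤ d) (δ : ℝ) (hδ : 0 < δ) :
    ∃ q : K[X], q.natDegree ≤ d ∧ ∀ k, |(p ^ 2).coeff k - ((q ^ 2).coeff k : ℝ)| < δ := by
  let P : (ℕ → ℝ) → ℝ[X] := fun b => ∑ i ∈ Finset.range (d + 1), C (b i) * X ^ i
  have hP : ∀ b i, (P b).coeff i = if i < d + 1 then b i else 0 := by
    intro b i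
    simp [P, coeff_X_pow]
  have hPp : P p.coeff = p := by
    ext i
    rw [hP]
    split_ifs with h
    · rfl
    · exact (coeff_eq_zero_of_natDegree_lt (by omega)).symm
  have hcont : ∀ k, Continuous fun b => ((P b) ^ 2).coeff k := by
    intro k
    simp only [sq, coeff_mul, hP]
    refine continuous_finsetSum _ fun x _ => ?_
    refine Continuous.mul ?_ ?_ <;> split_ifs <;> fun_prop
  have hev : ∀ᶠ b in nhds p.coeff, ∀ k ∈ Finset.range (2 * d + 1),
      |(p ^ 2).coeff k - ((P b) ^ 2).coeff k| < δ := by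
    rw [Filter.eventually_all_finset]
    intro k _
    have h1 : Continuous fun b => |(p ^ 2).coeff k - ((P b) ^ 2).coeff k| :=
      (continuous_const.sub (hcont k)).abs
    refine h1.continuousAt.eventually_lt continuousAt_const ?_
    simpa [hPp] using hδ
  have hden : DenseRange (Pi.map fun (_ : ℕ) (x : ℚ) => (x : ℝ)) :=
    DenseRange.piMap fun _ => Rat.denseRange_cast
  obtain ⟨_, hb, b, rfl⟩ := (mem_closure_iff_nhds.1 (hden p.coeff)) _ hev
  let q : K[X] := ∑ i ∈ Finset.range (d + 1), C (b i : K) * X ^ i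
  have hq : q.map K.subtype = P (Pi.map (fun (_ : ℕ) (x : ℚ) => (x : ℝ)) b) := by
    simp [q, P, Polynomial.map_sum]
  have hqd : q.natDegree ≤ d := by
    refine natDegree_sum_le_of_forall_le _ _ fun i hi => ?_
    refine (natDegree_C_mul_X_pow_le _ _).trans ?_
    simp at hi; omega
  refine ⟨q, hqd, fun k => ?_⟩
  by_cases hk : k ∈ Finset.range (2 * d + 1)
  · have := hb k hk
    rw [← hq, ← Polynomial.map_pow, coeff_map] at this
    exact this
  · simp at hk
    rw [coeff_eq_zero_of_natDegree_lt (p := p ^ 2), coeff_eq_zero_of_natDegree_lt (p := q ^ 2)]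
    · simpa using hδ
    · exact lt_of_le_of_lt (natDegree_pow_le_of_le 2 hqd) (by omega)
    · exact lt_of_le_of_lt (natDegree_pow_le_of_le 2 hp) (by omega)

lemma approx (K : Subfield ℝ) (d : ℕ) {F : ℝ[X]} (hF : F ∈ RS d) : ∀ (δ : ℝ), 0 < δ →
    ∃ q ∈ WS K, q.natDegree ≤ 2 * d ∧ ∀ k, |F.coeff k - (q.coeff k : ℝ)| < δ := by
  induction hF using AddSubmonoid.closure_induction with
  | mem x h =>
    obtain ⟨g, h, rfl⟩ := h
    intro δ hδ
    obtain ⟨q, hq, hk⟩ := approx_sq K d g h δ hδ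
    refine ⟨q ^ 2, ?_, ?_, hk⟩
    · simpa using WS_mem 1 q (by simp)
    · exact (natDegree_pow_le_of_le 2 hq)
  | zero => exact fun δ hδ => ⟨0, zero_mem _, by simp, by simpa using hδ⟩
  | add x y _ _ hx hy =>
    intro δ hδ
    obtain ⟨q, h1, h2, h3⟩ := hx (δ / 2) (by positivity)
    obtain ⟨r, h4, h5, h6⟩ := hy (δ / 2) (by positivity)
    refine ⟨q + r, add_mem h1 h4, natDegree_add_le_of_degree_le h2 h5, fun k => ?_⟩
    have h3 := abs_lt.1 (h3 k)
    have h6 := abs_lt.1 (h6 k)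
    simp only [coeff_add, Subfield.coe_add, abs_lt]
    constructor <;> linarith [h3.1, h3.2, h6.1, h6.2]

lemma perturb (K : Subfield ℝ) (a : ℕ → K) (ε : K) (ha : ∀ k, |(a k : ℝ)| ≤ ε) (d : ℕ) :
    (∑ k ∈ Finset.range (2 * d + 1), C (a k) * X ^ k)
      + C (3 * ε) * (∑ i ∈ Finset.range (d + 1), X ^ (2 * i)) - C ε * X ^ (2 * d) ∈ WS K := by
  induction d with
  | zero =>
    have := WS_mem (a 0 + 2 * ε) 1 (by
      have := abs_le.1 (ha 0)
      push_cast
      have two : ((2 : K) : ℝ) = 2 := rfl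
      try rw [two]
      linarith [this.1, this.2])
    convert this using 1
    simp only [C_add, C_mul, map_ofNat]
    simp
    ring
  | succ d ih =>
    have h1 := abs_le.1 (ha (2 * d + 1))
    have h2 := abs_le.1 (ha (2 * d + 2))
    have e1 := WS_mem ((ε + a (2 * d + 1) / 2) / 2) (X ^ d + X ^ (d + 1)) (by
      push_cast
      have two : ((2 : K) : ℝ) = 2 := rfl
      try rw [two]
      linarith [h1.1, h1.2])
    have e2 := WS_mem ((ε - a (2 * d + 1) / 2) / 2) (X ^ d - X ^ (d + 1)) (by
      push_cast
      have two : ((2 : K) : ℝ) = 2 := rfl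
      try rw [two]
      linarith [h1.1, h1.2])
    have e3 := WS_mem (a (2 * d + 2) + ε) (X ^ (d + 1)) (by
      push_cast
      have two : ((2 : K) : ℝ) = 2 := rfl
      try rw [two]
      linarith [h2.1, h2.2])
    have := add_mem (add_mem (add_mem ih e1) e2) e3
    convert this using 1
    rw [show 2 * (d + 1) + 1 = 2 * d + 1 + 1 + 1 by ring, Finset.sum_range_succ,
      Finset.sum_range_succ _ (2 * d + 1), Finset.sum_range_succ _ (d + 1)]
    generalize a (2 * d + 1) = u
    generalize a (2 * d + 1 + 1) = v
    have hu : ∃ w : K, u = 4 * w := ⟨u / 4, by ring⟩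
    have he : ∃ w : K, ε = 2 * w := ⟨ε / 2, by ring⟩
    obtain ⟨u, rfl⟩ := hu
    obtain ⟨e, rfl⟩ := he
    rw [show (2 * e + 4 * u / 2) / 2 = e + u by ring, show (2 * e - 4 * u / 2) / 2 = e - u by ring]
    simp only [C_add, C_sub, C_mul, map_ofNat]
    ring

lemma pos_lower {F : ℝ[X]} (hF : ∀ x, 0 < F.eval x) {d : ℕ} (hd : F.natDegree = 2 * d) :
    ∃ η : ℝ, 0 < η ∧ ∀ x, η * ∑ i ∈ Finset.range (d + 1), x ^ (2 * i) ≤ F.eval x := by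
  have hF0 : F ≠ 0 := by rintro rfl; simpa using hF 0
  have hlc := (even_pos _ F rfl hF0 fun x => (hF x).le).2
  have hrev : ∀ x : ℝ, x ≠ 0 → F.reverse.eval x⁻¹ * x ^ (2 * d) = F.eval x := by
    intro x hx
    letI := invertibleOfNonzero hx
    have := eval₂_reverse_mul_pow (RingHom.id ℝ) x F
    rw [hd, invOf_eq_inv] at this
    exact this
  have hR : ∀ y, 0 < F.reverse.eval y := by
    intro y
    by_cases hy : y = 0
    · subst hy
      rw [← coeff_zero_eq_eval_zero, coeff_zero_reverse]; exact hlc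
    · have := hrev y⁻¹ (inv_ne_zero hy)
      rw [inv_inv] at this
      have h2 := hF y⁻¹
      rw [← this] at h2
      refine pos_of_mul_pos_left h2 ?_
      rw [pow_mul]; positivity
  obtain ⟨y1, _, h1⟩ := (isCompact_Icc (a := (-1 : ℝ)) (b := 1)).exists_isMinOn ⟨0, by simp⟩
    F.continuous.continuousOn
  obtain ⟨y2, _, h2⟩ := (isCompact_Icc (a := (-1 : ℝ)) (b := 1)).exists_isMinOn ⟨0, by simp⟩
    F.reverse.continuous.continuousOn
  have hmpos : 0 < min (F.eval y1) (F.reverse.eval y2) := lt_min (hF _) (hR _)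
  set m := min (F.eval y1) (F.reverse.eval y2) with hm
  refine ⟨m / (d + 1), by positivity, fun x => ?_⟩
  rcases le_total |x| 1 with hx | hx
  · have hs : ∑ i ∈ Finset.range (d + 1), x ^ (2 * i) ≤ (d + 1 : ℝ) := by
      have : ∀ i ∈ Finset.range (d + 1), x ^ (2 * i) ≤ (1 : ℝ) := fun i _ => by
        rw [pow_mul]; exact pow_le_one₀ (sq_nonneg x) ((sq_le_one_iff_abs_le_one x).2 hx)
      simpa using Finset.sum_le_sum this
    calc _ ≤ m / (d + 1) * (d + 1 : ℝ) := by gcongr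
      _ = m := by field_simp
      _ ≤ F.eval y1 := min_le_left _ _
      _ ≤ _ := h1 (abs_le.1 hx)
  · have hs : ∑ i ∈ Finset.range (d + 1), x ^ (2 * i) ≤ (d + 1 : ℝ) * x ^ (2 * d) := by
      have : ∀ i ∈ Finset.range (d + 1), x ^ (2 * i) ≤ x ^ (2 * d) := fun i hi => by
        rw [pow_mul, pow_mul]
        exact pow_le_pow_right₀ ((one_le_sq_iff_one_le_abs x).2 hx)
          (by simp at hi; omega)
      simpa using Finset.sum_le_sum this
    have hx0 : x ≠ 0 := by rintro rfl; norm_num at hx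
    have hxp : 0 ≤ x ^ (2 * d) := by rw [pow_mul]; positivity
    have hi : |x⁻¹| ≤ 1 := by rw [abs_inv]; exact inv_le_one_of_one_le₀ hx
    have h3 : F.reverse.eval y2 ≤ F.reverse.eval x⁻¹ := h2 (abs_le.1 hi)
    calc _ ≤ m / (d + 1) * ((d + 1 : ℝ) * x ^ (2 * d)) := by gcongr
      _ = m * x ^ (2 * d) := by field_simp
      _ ≤ F.reverse.eval x⁻¹ * x ^ (2 * d) := by
        gcongr
        exact (min_le_right _ _).trans h3
      _ = _ := hrev x hx0

lemma pos_case (K : Subfield ℝ) (f : K[X]) (hf : ∀ x : ℝ, 0 < (f.map K.subtype).eval x) :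
    f ∈ WS K := by
  have hF0 : f.map K.subtype ≠ 0 := by intro h; simpa [h] using hf 0
  obtain ⟨d, hd⟩ := even_iff_exists_two_mul.1 (even_pos _ _ rfl hF0 fun x => (hf x).le).1
  obtain ⟨η, hη, hl⟩ := pos_lower hf hd
  obtain ⟨e, he0, he⟩ := exists_rat_btwn (show (0 : ℝ) < η / 3 by positivity)
  set ε : K := (e : K) with hε
  have hεr : (ε : ℝ) = e := by simp [hε]
  let S : K[X] := ∑ i ∈ Finset.range (d + 1), X ^ (2 * i)
  have hSd : S.natDegree ≤ 2 * d := by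
    refine natDegree_sum_le_of_forall_le _ _ fun i hi => ?_
    simp at hi ⊢; omega
  let g : K[X] := f - C (3 * ε) * S
  have hfd : f.natDegree = 2 * d := by rwa [natDegree_map] at hd
  have hgd : g.natDegree ≤ 2 * d :=
    natDegree_sub_le_of_le hfd.le ((natDegree_C_mul_le _ _).trans hSd) |>.trans (by simp)
  have hg : ∀ x : ℝ, 0 ≤ (g.map K.subtype).eval x := by
    intro x
    have h1 := hl x
    have h2 : (S.map K.subtype).eval x = ∑ i ∈ Finset.range (d + 1), x ^ (2 * i) := by
      simp [S, Polynomial.map_sum, eval_finsetSum]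
    have h3 : 0 ≤ ∑ i ∈ Finset.range (d + 1), x ^ (2 * i) :=
      Finset.sum_nonneg fun i _ => by rw [pow_mul]; positivity
    have h4 : (g.map K.subtype).eval x = (f.map K.subtype).eval x
        - 3 * (ε : ℝ) * (S.map K.subtype).eval x := by
      simp only [g, Polynomial.map_sub, Polynomial.map_mul, Polynomial.map_C, eval_sub, eval_mul,
        eval_C]
      have three : ((3 : K) : ℝ) = 3 := rfl
      simp [three]
    rw [h4, h2, hεr]
    nlinarith
  obtain ⟨q, hq, hqd, hqk⟩ := approx K d
    (real_sos d (g.map K.subtype) (by rwa [natDegree_map]) hg) (ε : ℝ) (by rw [hεr]; exact he0)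
  have hp := perturb K (g - q).coeff ε (fun k => by
    have := (hqk k).le
    rw [coeff_map] at this
    simpa using this) d
  have hr : ∑ k ∈ Finset.range (2 * d + 1), C ((g - q).coeff k) * X ^ k = g - q := by
    refine (as_sum_range_C_mul_X_pow' _ ?_).symm
    exact Nat.lt_succ_of_le ((natDegree_sub_le_of_le hgd hqd).trans (by simp))
  rw [hr] at hp
  have hlast := WS_mem ε (X ^ d) (by rw [hεr]; exact he0.le)
  have := add_mem (add_mem hp hlast) hq
  convert this using 1
  simp only [g, S]
  ring

lemma K_root (K : Subfield ℝ) {f : K[X]} (h0 : f ≠ 0)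
    (hf : ∀ x : ℝ, 0 ≤ (f.map K.subtype).eval x) {a : ℝ} (ha : (f.map K.subtype).eval a = 0) :
    ∃ p h : K[X], 0 < p.natDegree ∧ f = p ^ 2 * h ∧ ∀ x : ℝ, 0 ≤ (h.map K.subtype).eval x := by
  have hda := deriv_root hf ha
  rw [derivative_map] at hda
  have ev : ∀ g : K[X], (g.map K.subtype).eval a = aeval a g := fun g => by
    rw [eval_map, aeval_def]; rfl
  rw [ev] at ha hda
  have hint : IsIntegral K a := IsAlgebraic.isIntegral ⟨f, h0, ha⟩
  have hirr := minpoly.irreducible hint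
  have hsep := hirr.separable.aeval_derivative_ne_zero (minpoly.aeval K a)
  obtain ⟨g, hg⟩ := minpoly.dvd K a ha
  have hga : aeval a g = 0 := by
    rw [hg] at hda
    simpa [minpoly.aeval, hsep] using hda
  obtain ⟨h, hh⟩ := minpoly.dvd K a hga
  have hfe : f = (minpoly K a) ^ 2 * h := by rw [hg, sq, mul_assoc, ← hh]
  refine ⟨minpoly K a, h, minpoly.natDegree_pos hint, hfe, ?_⟩
  refine nonneg_of_sq_mul (p := (minpoly K a).map K.subtype) ?_ ?_
  · exact (Polynomial.map_ne_zero_iff K.subtype.injective).2 (minpoly.ne_zero hint)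
  · rw [← Polynomial.map_pow, ← Polynomial.map_mul, ← hfe]; exact hf

lemma main (K : Subfield ℝ) : ∀ (n : ℕ) (f : K[X]), f.natDegree = n →
    (∀ x : ℝ, 0 ≤ (f.map K.subtype).eval x) → f ∈ WS K := by
  intro n
  induction n using Nat.strong_induction_on with
  | _ n ih =>
  intro f hn hf
  by_cases h0 : f = 0
  · rw [h0]; exact zero_mem _
  by_cases hr : ∃ a, (f.map K.subtype).eval a = 0
  · obtain ⟨a, ha⟩ := hr
    obtain ⟨p, h, hp, hfe, hh⟩ := K_root K h0 hf ha
    have hne : p ^ 2 ≠ 0 ∧ h ≠ 0 := by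
      rw [hfe] at h0; exact mul_ne_zero_iff.1 h0
    have hd : f.natDegree = 2 * p.natDegree + h.natDegree := by
      rw [hfe, natDegree_mul hne.1 hne.2, natDegree_pow]
    rw [hfe]
    exact WS_sq_mul p (ih _ (by omega) h rfl hh)
  · push Not at hr
    exact pos_case K f fun x => lt_of_le_of_ne (hf x) (hr x).symm

end LP

/-- Landau–Pourchet: a univariate polynomial over a subfield K of ℝ is non-negative on ℝ
iff it is a weighted sum of squares with positive weights in K. -/
theorem landau_pourchet (K : Subfield ℝ) (f : Polynomial K) :
    (∀ x : ℝ, 0 ≤ (f.map K.subtype).eval x) ↔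
    ∃ (s : ℕ), 0 < s ∧ ∃ (c : Fin s → K) (g : Fin s → Polynomial K),
      (∀ j, 0 < (c j : ℝ)) ∧ f = ∑ j, Polynomial.C (c j) * (g j) ^ 2 := by
  constructor
  · intro h
    exact LP.WS_out (LP.main K _ f rfl h)
  · rintro ⟨s, _, c, g, hc, rfl⟩ x
    rw [Polynomial.map_sum, Polynomial.eval_finsetSum]
    refine Finset.sum_nonneg fun j _ => ?_
    rw [Polynomial.map_mul, Polynomial.map_pow, Polynomial.map_C, Polynomial.eval_mul,
      Polynomial.eval_pow, Polynomial.eval_C]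
    exact mul_nonneg (hc j).le (sq_nonneg _)
end

section
/- Let f ∈ ℚ[x₁,…,xₙ] be non-negative on ℝⁿ, assume the gradient ideal I_grad(f) is zero-dimensional and radical, and assume all points of the complex gradient variety V_grad(f) have pairwise distinct x₁-coordinates. Then there exist univariate polynomials w, v₂,…,vₙ ∈ ℚ[x₁] generating I_grad(f) as ⟨w, x₂−v₂,…,xₙ−vₙ⟩, polynomials q₁,…,q_s ∈ ℚ[x₁], positive rationals c₁,…,c_s, and polynomials φ₂,…,φₙ ∈ ℚ[x₁,…,xₙ] such that f = Σⱼ cⱼ qⱼ(x₁)² + Σᵢ₌₂ⁿ φᵢ·(xᵢ − vᵢ(x₁)). -/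
namespace SosAux
open Polynomial

theorem nonneg_of_sq_mul {p k : ℝ[X]} (hp : p ≠ 0)
    (h : ∀ x, 0 ≤ (p ^ 2 * k).eval x) : ∀ x, 0 ≤ k.eval x := by
  have hfin : {x | p.eval x = 0}.Finite := by
    refine (p.roots.toFinset.finite_toSet).subset fun x hx => ?_
    simp only [Finset.mem_coe, Multiset.mem_toFinset]
    exact (mem_roots hp).2 hx
  have hd : Dense {x | p.eval x = 0}ᶜ := Set.Countable.dense_compl ℝ hfin.countable
  have hc : IsClosed {x | 0 ≤ k.eval x} := isClosed_le continuous_const k.continuous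
  intro x
  have hsub : {x | p.eval x = 0}ᶜ ⊆ {x | 0 ≤ k.eval x} := by
    intro y hy
    have h1 := h y
    rw [eval_mul, eval_pow] at h1
    have hy' : p.eval y ≠ 0 := hy
    have : 0 < p.eval y ^ 2 := by positivity
    exact nonneg_of_mul_nonneg_right h1 this
  have hcl := closure_minimal hsub hc
  rw [hd.closure_eq] at hcl
  exact hcl (Set.mem_univ x)

theorem deriv_zero {g : ℝ[X]} (h : ∀ x, 0 ≤ g.eval x) {a : ℝ} (ha : g.eval a = 0) :
    g.derivative.eval a = 0 := by
  have : IsLocalMin (fun x => g.eval x) a := by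
    refine Filter.Eventually.of_forall fun x => ?_
    simp only [ha]; exact h x
  have h2 := this.deriv_eq_zero
  simpa using h2

theorem real_two_sq (N : ℕ) : ∀ g : ℝ[X], g.natDegree ≤ N → (∀ x, 0 ≤ g.eval x) →
    ∃ u v : ℝ[X], g = u ^ 2 + v ^ 2 := by
  induction N using Nat.strong_induction_on with
  | _ N ih =>
  intro g hN h
  by_cases hd : g.natDegree = 0
  · obtain ⟨c, rfl⟩ := natDegree_eq_zero.1 hd
    have hc : 0 ≤ c := by simpa using h 0
    refine ⟨C (Real.sqrt c), 0, ?_⟩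
    rw [← C_pow, Real.sq_sqrt hc]; simp
  have hg0 : g ≠ 0 := by rintro rfl; simp at hd
  obtain ⟨z, hz⟩ := IsAlgClosed.exists_aeval_eq_zero ℂ g
    (by intro h0; exact hd (natDegree_eq_of_degree_eq_some h0))
  by_cases him : z.im = 0
  · have hr : g.eval z.re = 0 := by
      have : z = ((z.re : ℝ) : ℂ) := by apply Complex.ext <;> simp [him]
      rw [this] at hz
      have h3 : aeval ((algebraMap ℝ ℂ) z.re) g = 0 := hz
      rw [aeval_algebraMap_apply] at h3
      simpa using h3
    have hm := (one_lt_rootMultiplicity_iff_isRoot hg0).2 ⟨hr, deriv_zero h hr⟩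
    have hdv : (X - C z.re) ^ 2 ∣ g := (le_rootMultiplicity_iff hg0).1 hm
    obtain ⟨k, rfl⟩ := hdv
    have hk0 : k ≠ 0 := right_ne_zero_of_mul hg0
    have hk := nonneg_of_sq_mul (X_sub_C_ne_zero _) h
    have hdeg : ((X - C z.re) ^ 2 * k).natDegree = 2 + k.natDegree := by
      rw [natDegree_mul (pow_ne_zero _ (X_sub_C_ne_zero _)) hk0]; simp
    obtain ⟨u, v, huv⟩ := ih k.natDegree (by omega) k le_rfl hk
    exact ⟨(X - C z.re) * u, (X - C z.re) * v, by rw [huv]; ring⟩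
  · obtain ⟨k, hk⟩ := quadratic_dvd_of_aeval_eq_zero_im_ne_zero g hz him
    have hq : (X ^ 2 - C (2 * z.re) * X + C (‖z‖ ^ 2) : ℝ[X]) = (X - C z.re) ^ 2 + (C z.im) ^ 2 := by
      rw [← Complex.normSq_eq_norm_sq, Complex.normSq_apply]
      simp only [C_mul, C_add, C_ofNat]; ring
    rw [hq] at hk
    have hqd : ((X - C z.re) ^ 2 + (C z.im) ^ 2 : ℝ[X]).natDegree = 2 := by
      rw [← C_pow, natDegree_add_C]; simp
    have hk0 : k ≠ 0 := by rintro rfl; simp at hk; exact hg0 hk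
    have hdeg : g.natDegree = 2 + k.natDegree := by
      rw [hk, natDegree_mul (by intro h0; rw [h0] at hqd; simp at hqd) hk0, hqd]
    have hkn : ∀ x, 0 ≤ k.eval x := by
      intro x
      have h1 := h x
      rw [hk] at h1
      simp only [eval_mul, eval_add, eval_pow, eval_sub, eval_X, eval_C] at h1
      have : 0 < (x - z.re) ^ 2 + z.im ^ 2 := by positivity
      exact nonneg_of_mul_nonneg_right h1 this
    obtain ⟨u, v, huv⟩ := ih k.natDegree (by omega) k le_rfl hkn
    exact ⟨(X - C z.re) * u + C z.im * v, (X - C z.re) * v - C z.im * u, by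
      rw [hk, huv]; ring⟩

theorem natDegree_sq_add {u v : ℝ[X]} (h : v.natDegree ≤ u.natDegree) :
    (u ^ 2 + v ^ 2).natDegree = 2 * u.natDegree := by
  by_cases hu : u = 0
  · subst hu
    have : v.natDegree = 0 := by simpa using h
    simp [natDegree_pow, this]
  refine natDegree_eq_of_le_of_coeff_ne_zero ?_ ?_
  · refine natDegree_add_le_of_degree_le ?_ ?_ <;> rw [natDegree_pow]
    omega
  · rw [coeff_add, coeff_pow_of_natDegree_le le_rfl, coeff_pow_of_natDegree_le h]
    have : u.coeff u.natDegree ≠ 0 := by simpa using hu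
    positivity

theorem real_two_sq' (g : ℝ[X]) (h : ∀ x, 0 ≤ g.eval x) :
    ∃ (u v : ℝ[X]) (d : ℕ), g = u ^ 2 + v ^ 2 ∧ u.natDegree ≤ d ∧ v.natDegree ≤ d ∧
      g.natDegree = 2 * d := by
  obtain ⟨u, v, rfl⟩ := real_two_sq _ g le_rfl h
  rcases le_total v.natDegree u.natDegree with h1 | h1
  · exact ⟨u, v, _, rfl, le_rfl, h1, natDegree_sq_add h1⟩
  · exact ⟨u, v, v.natDegree, rfl, h1, le_rfl, by rw [add_comm]; exact natDegree_sq_add h1⟩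

theorem isSumSq_C {c : ℚ} (hc : 0 ≤ c) : IsSumSq (C c : ℚ[X]) := by
  have h1 : c = ((c.num.toNat * c.den : ℕ) : ℚ) * ((1 / c.den) * (1 / c.den)) := by
    have h2 : ((c.num.toNat : ℕ) : ℚ) = (c.num : ℚ) := by
      have : ((c.num.toNat : ℕ) : ℤ) = c.num := Int.toNat_of_nonneg (Rat.num_nonneg.2 hc)
      exact_mod_cast this
    push_cast
    rw [h2]
    have h3 : (c.den : ℚ) ≠ 0 := by exact_mod_cast c.den_ne_zero
    field_simp
    exact Rat.mul_den_eq_num c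
  rw [h1, C_mul, C_mul]
  refine IsSumSq.mul ?_ (IsSumSq.mul_self _)
  rw [map_natCast]
  exact IsSumSq.natCast _

theorem absorb (a : ℚ) (c : ℕ → ℚ) (hc : ∀ k, |c k| ≤ a) (d : ℕ) :
    IsSumSq ((∑ k ∈ Finset.range (2 * d + 1), C (c k) * X ^ k)
      + C (3 * a) * (∑ j ∈ Finset.range (d + 1), X ^ (2 * j)) - C a * X ^ (2 * d) : ℚ[X]) := by
  have ha : 0 ≤ a := (abs_nonneg _).trans (hc 0)
  induction d with
  | zero =>
    have : IsSumSq (C (c 0 + 2 * a) : ℚ[X]) := isSumSq_C (by have := abs_le.1 (hc 0); linarith)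
    convert this using 1
    simp only [C_mul, C_add, C_ofNat]
    simp
    ring
  | succ d ih =>
    have h1 := abs_le.1 (hc (2 * d + 1))
    have h2 := abs_le.1 (hc (2 * d + 2))
    have e1 := isSumSq_C (c := a / 2 + c (2 * d + 1) / 4) (by linarith)
    have e2 := isSumSq_C (c := a / 2 - c (2 * d + 1) / 4) (by linarith)
    have e3 := isSumSq_C (c := c (2 * d + 2) + a) (by linarith)
    have := ((ih.add (e1.mul (IsSumSq.mul_self (X ^ d * (1 + X))))).add
      (e2.mul (IsSumSq.mul_self (X ^ d * (1 - X))))).add (e3.mul (IsSumSq.mul_self (X ^ (d + 1))))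
    refine (congrArg IsSumSq ?_).mpr this
    rw [show 2 * (d + 1) + 1 = (2 * d + 1) + 1 + 1 by ring, Finset.sum_range_succ,
      Finset.sum_range_succ, Finset.sum_range_succ (n := d + 1)]
    have hA : (C a : ℚ[X]) = 2 * C (a / 2) := by
      rw [show (2 : ℚ[X]) = C 2 from rfl, ← C_mul]; congr 1; ring
    have hB : (C (c (2 * d + 1)) : ℚ[X]) = 4 * C (c (2 * d + 1) / 4) := by
      rw [show (4 : ℚ[X]) = C 4 from rfl, ← C_mul]; congr 1; ring
    rw [C_add, C_sub, C_add, C_mul, hB, hA]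
    simp only [C_ofNat]
    ring

theorem lower_bound (g S : ℝ[X]) (hg : ∀ x, 0 < g.eval x) (hS : S.natDegree ≤ g.natDegree) :
    ∃ M : ℝ, 0 < M ∧ ∀ x, S.eval x ≤ M * g.eval x := by
  have key : ∀ g S : ℝ[X], (∀ x, 0 < g.eval x) → S.natDegree ≤ g.natDegree →
      ∃ M : ℝ, 0 < M ∧ ∀ x, 0 ≤ x → S.eval x ≤ M * g.eval x := by
    intro g S hg hS
    have hg0 : g ≠ 0 := by rintro rfl; simpa using hg 0
    have hdeg : S.degree ≤ g.degree := by
      rw [degree_eq_natDegree hg0]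
      exact natDegree_le_iff_degree_le.1 hS
    obtain ⟨c, hc⟩ := (Polynomial.isBigO_atTop_of_degree_le S g hdeg).bound
    obtain ⟨A, hA⟩ := Filter.eventually_atTop.1 hc
    have hcont : ContinuousOn (fun x => S.eval x / g.eval x) (Set.Icc 0 A) :=
      (S.continuous.div g.continuous fun x => (hg x).ne').continuousOn
    obtain ⟨B, hB⟩ := isCompact_Icc.bddAbove_image hcont
    refine ⟨max (max c B) 1, by positivity, fun x hx => ?_⟩
    rcases le_total x A with h | h
    · have := hB ⟨x, ⟨hx, h⟩, rfl⟩
      simp only at this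
      rw [div_le_iff₀ (hg x)] at this
      refine this.trans ?_
      have := (hg x).le
      gcongr
      exact (le_max_right _ _).trans (le_max_left _ _)
    · have := hA x h
      rw [Real.norm_eq_abs, Real.norm_eq_abs, abs_of_pos (hg x)] at this
      refine (le_abs_self _).trans (this.trans ?_)
      have := (hg x).le
      gcongr
      exact (le_max_left _ _).trans (le_max_left _ _)
  obtain ⟨M1, h1, hM1⟩ := key g S hg hS
  obtain ⟨M2, h2, hM2⟩ := key (g.comp (-X)) (S.comp (-X)) (by intro x; simpa using hg _)
    (by simpa [natDegree_comp] using hS)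
  refine ⟨max M1 M2, by positivity, fun x => ?_⟩
  have hx' := (hg x).le
  rcases le_total 0 x with h | h
  · refine (hM1 x h).trans ?_
    gcongr; exact le_max_left _ _
  · have := hM2 (-x) (by linarith)
    simp only [eval_comp, eval_neg, eval_X, neg_neg] at this
    refine this.trans ?_
    gcongr; exact le_max_right _ _

theorem approx (u : ℝ[X]) : ∃ q : ℕ → ℚ[X], (∀ m, (q m).natDegree ≤ u.natDegree) ∧
    ∀ k, Filter.Tendsto (fun m => (((q m).coeff k : ℚ) : ℝ)) Filter.atTop (nhds (u.coeff k)) := by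
  have : ∀ x : ℝ, ∃ r : ℕ → ℚ, Filter.Tendsto (fun m => (r m : ℝ)) Filter.atTop (nhds x) := by
    intro x
    have h1 : ∀ m : ℕ, ∃ r : ℚ, x < r ∧ (r : ℝ) < x + 1 / ((m : ℝ) + 1) := fun m =>
      exists_rat_btwn (by have : (0:ℝ) < 1 / ((m : ℝ) + 1) := by positivity
                          linarith)
    choose r hr1 hr2 using h1
    refine ⟨r, tendsto_of_tendsto_of_tendsto_of_le_of_le tendsto_const_nhds
      ?_ (fun m => (hr1 m).le) (fun m => (hr2 m).le)⟩
    simpa using (tendsto_const_nhds (x := x)).add (tendsto_one_div_add_atTop_nhds_zero_nat (𝕜 := ℝ))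
  choose r hr using this
  refine ⟨fun m => ∑ k ∈ Finset.range (u.natDegree + 1), C (r (u.coeff k) m) * X ^ k, ?_, ?_⟩
  · intro m
    refine natDegree_sum_le_of_forall_le _ _ fun k hk => ?_
    refine (natDegree_C_mul_X_pow_le _ _).trans ?_
    simp at hk; omega
  · intro k
    simp only [finsetSum_coeff, coeff_C_mul_X_pow]
    by_cases hk : k ≤ u.natDegree
    · have : ∀ m, (∑ x ∈ Finset.range (u.natDegree + 1), if k = x then r (u.coeff x) m else 0)
          = r (u.coeff k) m := by
        intro m
        rw [Finset.sum_ite_eq, if_pos (by simp; omega)]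
      simp only [this]
      exact hr _
    · have : ∀ m, (∑ x ∈ Finset.range (u.natDegree + 1), if k = x then r (u.coeff x) m else 0)
          = 0 := by
        intro m
        rw [Finset.sum_ite_eq, if_neg (by simp; omega)]
      simp only [this]
      rw [coeff_eq_zero_of_natDegree_lt (by omega)]
      simp

theorem tendsto_sq {u : ℝ[X]} {q : ℕ → ℚ[X]}
    (h : ∀ k, Filter.Tendsto (fun m => (((q m).coeff k : ℚ) : ℝ)) Filter.atTop (nhds (u.coeff k)))
    (k : ℕ) :
    Filter.Tendsto (fun m => ((((q m) ^ 2).coeff k : ℚ) : ℝ)) Filter.atTop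
      (nhds ((u ^ 2).coeff k)) := by
  simp only [sq, coeff_mul, Rat.cast_sum, Rat.cast_mul]
  exact tendsto_finsetSum _ fun i _ => (h _).mul (h _)

theorem pos_case (g : ℚ[X]) (hg : ∀ x : ℝ, 0 < aeval x g) : IsSumSq g := by
  set G : ℝ[X] := g.map (algebraMap ℚ ℝ) with hG
  have hGe : ∀ x, G.eval x = aeval x g := fun x => by rw [hG, eval_map_algebraMap]
  obtain ⟨-, -, d, -, -, -, hd⟩ := real_two_sq' G (fun x => by rw [hGe]; exact (hg x).le)
  have hgd : g.natDegree = 2 * d := by rw [← hd, hG, natDegree_map]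
  set S : ℚ[X] := ∑ j ∈ Finset.range (d + 1), X ^ (2 * j) with hS
  have hSd : S.natDegree ≤ 2 * d := by
    refine natDegree_sum_le_of_forall_le _ _ fun k hk => ?_
    simp at hk ⊢; omega
  obtain ⟨M, hM, hb⟩ := lower_bound G (S.map (algebraMap ℚ ℝ)) (fun x => by rw [hGe]; exact hg x)
    (by rw [natDegree_map, hd]; exact hSd)
  obtain ⟨a, ha0, ha⟩ := exists_rat_btwn (show (0:ℝ) < 1 / (3 * M) by positivity)
  have ha0' : (0:ℚ) < a := by exact_mod_cast ha0
  set H : ℚ[X] := g - C (3 * a) * S with hH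
  have hHn : ∀ x, 0 ≤ (H.map (algebraMap ℚ ℝ)).eval x := by
    intro x
    have h1 := hb x
    have h0 : 0 < G.eval x := by rw [hGe]; exact hg x
    rw [hH, Polynomial.map_sub, Polynomial.map_mul, map_C, eval_sub, eval_mul, eval_C, ← hG]
    rw [lt_div_iff₀ (by positivity)] at ha
    have : (algebraMap ℚ ℝ) (3 * a) = 3 * (a : ℝ) := by simp
    rw [this]
    have h2 : 3 * (a:ℝ) * eval x (S.map (algebraMap ℚ ℝ)) ≤ 3 * (a:ℝ) * (M * G.eval x) := by
      gcongr
    nlinarith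
  have hHd : H.natDegree ≤ 2 * d := by
    refine (natDegree_sub_le _ _).trans (max_le hgd.le ?_)
    exact (natDegree_C_mul_le _ _).trans hSd
  obtain ⟨u, v, d', huv, hu, hv, hd'⟩ := real_two_sq' _ hHn
  rw [natDegree_map] at hd'
  obtain ⟨p, hp1, hp2⟩ := approx u
  obtain ⟨q, hq1, hq2⟩ := approx v
  have ht : ∀ k, Filter.Tendsto (fun m => (((H - p m ^ 2 - q m ^ 2).coeff k : ℚ) : ℝ)) Filter.atTop
      (nhds 0) := by
    intro k
    have h1 : ((H.coeff k : ℚ) : ℝ) = (u ^ 2).coeff k + (v ^ 2).coeff k := by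
      rw [← coeff_add, ← huv, coeff_map]; rfl
    have h2 : Filter.Tendsto (fun m => ((H.coeff k : ℚ) : ℝ) - (((p m ^ 2).coeff k : ℚ) : ℝ)
        - (((q m ^ 2).coeff k : ℚ) : ℝ)) Filter.atTop
        (nhds (((H.coeff k : ℚ) : ℝ) - (u ^ 2).coeff k - (v ^ 2).coeff k)) :=
      (tendsto_const_nhds.sub (tendsto_sq hp2 k)).sub (tendsto_sq hq2 k)
    rw [h1] at h2
    simp only [coeff_sub, Rat.cast_sub]
    convert h2 using 2
    · rw [h1]
    · ring
  have hev : ∀ᶠ m in Filter.atTop, ∀ k ∈ Finset.range (2 * d + 1),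
      |(((H - p m ^ 2 - q m ^ 2).coeff k : ℚ) : ℝ)| < a := by
    rw [Filter.eventually_all_finset]
    intro k _
    have := (ht k).abs
    rw [abs_zero] at this
    exact this.eventually (gt_mem_nhds ha0)
  obtain ⟨m, hm⟩ := hev.exists
  set e := H - p m ^ 2 - q m ^ 2 with he
  have hed : e.natDegree ≤ 2 * d := by
    refine (natDegree_sub_le _ _).trans (max_le ((natDegree_sub_le _ _).trans (max_le hHd ?_)) ?_)
    · rw [natDegree_pow]; have := hp1 m; omega
    · rw [natDegree_pow]; have := hq1 m; omega
  have hsum : e = ∑ k ∈ Finset.range (2 * d + 1), C (e.coeff k) * X ^ k :=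
    as_sum_range_C_mul_X_pow' e (by omega)
  have hab := absorb a e.coeff (by
    intro k
    by_cases hk : k < 2 * d + 1
    · have := hm k (by simpa using hk)
      exact_mod_cast this.le
    · rw [coeff_eq_zero_of_natDegree_lt (by omega)]; simpa using ha0'.le) d
  rw [← hsum, ← hS] at hab
  have := ((hab.add ((isSumSq_C ha0'.le).mul (IsSumSq.mul_self (X ^ d)))).add
    (IsSumSq.mul_self (p m))).add (IsSumSq.mul_self (q m))
  refine (congrArg IsSumSq ?_).mpr this
  rw [he, hH]; ring

theorem rat_sumsq (N : ℕ) : ∀ g : ℚ[X], g.natDegree ≤ N → (∀ x : ℝ, 0 ≤ aeval x g) →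
    IsSumSq g := by
  induction N using Nat.strong_induction_on with
  | _ N ih =>
  intro g hN h
  by_cases hg0 : g = 0
  · subst hg0; exact IsSumSq.zero
  by_cases hr : ∃ α : ℝ, aeval α g = 0
  · obtain ⟨α, hα⟩ := hr
    have hint : IsIntegral ℚ α := IsAlgebraic.isIntegral ⟨g, hg0, hα⟩
    have hirr := minpoly.irreducible hint
    have hGe : ∀ (g : ℚ[X]) x, (g.map (algebraMap ℚ ℝ)).eval x = aeval x g :=
      fun g x => by rw [eval_map_algebraMap]
    have hder : aeval α g.derivative = 0 := by
      rw [← hGe, ← derivative_map]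
      exact deriv_zero (fun x => by rw [hGe]; exact h x) (by rw [hGe]; exact hα)
    obtain ⟨k, hk⟩ := minpoly.dvd ℚ α hα
    have hdd := minpoly.dvd ℚ α hder
    set p := minpoly ℚ α with hp
    have hsep : IsCoprime p (derivative p) := hirr.separable
    have hpk : p ∣ k := by
      rw [hk, derivative_mul] at hdd
      have : p ∣ derivative p * k := (dvd_add_left (dvd_mul_right p _)).1 hdd
      exact hsep.dvd_of_dvd_mul_left this
    obtain ⟨l, rfl⟩ := hpk
    have hgl : g = p ^ 2 * l := by rw [hk]; ring
    have hl0 : l ≠ 0 := by rintro rfl; simp at hgl; exact hg0 hgl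
    have hln : ∀ x : ℝ, 0 ≤ aeval x l := by
      have := nonneg_of_sq_mul (p := p.map (algebraMap ℚ ℝ)) (k := l.map (algebraMap ℚ ℝ))
        (by rw [Ne, Polynomial.map_eq_zero]; exact hirr.ne_zero)
        (fun x => by rw [← Polynomial.map_pow, ← Polynomial.map_mul, ← hgl, hGe]; exact h x)
      intro x; rw [← hGe]; exact this x
    have hpd : 0 < p.natDegree := minpoly.natDegree_pos hint
    have hdeg : g.natDegree = 2 * p.natDegree + l.natDegree := by
      rw [hgl, natDegree_mul (pow_ne_zero _ hirr.ne_zero) hl0, natDegree_pow]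
    have := ih l.natDegree (by omega) l le_rfl hln
    rw [hgl, sq]
    exact (IsSumSq.mul_self p).mul this
  · push Not at hr
    exact pos_case g fun x => lt_of_le_of_ne (h x) (hr x).symm

theorem sumsq_fin {g : ℚ[X]} (h : IsSumSq g) : ∃ (s : ℕ) (q : Fin s → ℚ[X]), g = ∑ j, q j ^ 2 := by
  induction h with
  | zero => exact ⟨0, fun _ => 0, by simp⟩
  | sq_add a _ ih =>
    obtain ⟨s, q, rfl⟩ := ih
    exact ⟨s + 1, Fin.cons a q, by simp [Fin.sum_univ_succ, sq]⟩

end SosAux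
namespace SosAux
open Polynomial

theorem descend (K : Type) [Field K] [Algebra ℚ K] [IsAlgClosed K] [Algebra.IsAlgebraic ℚ K]
    [IsGalois ℚ K] {n : ℕ} [NeZero n] (f : MvPolynomial (Fin n) ℚ)
    (hfin : {x : Fin n → ℂ | ∀ i, MvPolynomial.aeval x (MvPolynomial.pderiv i f) = 0}.Finite)
    (hrad : (Ideal.span (Set.range fun i => MvPolynomial.pderiv i f)).IsRadical)
    (hdist : ∀ x ∈ {x : Fin n → ℂ | ∀ i, MvPolynomial.aeval x (MvPolynomial.pderiv i f) = 0},
      ∀ y ∈ {x : Fin n → ℂ | ∀ i, MvPolynomial.aeval x (MvPolynomial.pderiv i f) = 0},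
      x 0 = y 0 → x = y) (i : Fin n) :
    ∃ v : ℚ[X], MvPolynomial.X i - Polynomial.aeval (MvPolynomial.X (0 : Fin n)) v ∈
      Ideal.span (Set.range fun i => MvPolynomial.pderiv i f) := by
  classical
  let ι : K →ₐ[ℚ] ℂ := IsAlgClosed.lift
  have hι : Function.Injective ι := ι.toRingHom.injective
  let V : Set (Fin n → K) := {x | ∀ i, MvPolynomial.aeval x (MvPolynomial.pderiv i f) = 0}
  have hmap : ∀ (L : Type) [Field L] [Algebra ℚ L] (σ : K →ₐ[ℚ] L) (x : Fin n → K)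
      (p : MvPolynomial (Fin n) ℚ),
      MvPolynomial.aeval (fun i => σ (x i)) p = σ (MvPolynomial.aeval x p) := by
    intro L _ _ σ x p
    have : MvPolynomial.aeval (fun i => σ (x i)) = σ.comp (MvPolynomial.aeval x) := by
      apply MvPolynomial.algHom_ext; intro i; simp
    rw [this]; rfl
  have hVmem : ∀ x ∈ V, (fun i => ι (x i)) ∈
      {x : Fin n → ℂ | ∀ i, MvPolynomial.aeval x (MvPolynomial.pderiv i f) = 0} := by
    intro x hx i
    rw [hmap ℂ ι, hx i, map_zero]
  have hcinj : Function.Injective (fun (x : Fin n → K) => fun i => ι (x i)) := by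
    intro x y hxy
    funext i
    exact hι (congrFun hxy i)
  have hVfin : V.Finite := Set.Finite.of_injOn (f := fun (x : Fin n → K) => fun i => ι (x i))
    hVmem hcinj.injOn hfin
  let s := hVfin.toFinset
  have hs : ∀ x, x ∈ s ↔ x ∈ V := fun x => hVfin.mem_toFinset
  have hinj : Set.InjOn (fun x : Fin n → K => x 0) s := by
    intro x hx y hy hxy
    have hx' := (hs x).1 hx
    have hy' := (hs y).1 hy
    apply hcinj
    exact hdist _ (hVmem x hx') _ (hVmem y hy') (congrArg ι hxy)
  let P : K[X] := Lagrange.interpolate s (fun x => x 0) (fun x => x i)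
  have hPe : ∀ x ∈ s, P.eval (x 0) = x i := fun x hx =>
    Lagrange.eval_interpolate_at_node (fun x : Fin n → K => x i) hinj hx
  have hPd : P.degree < s.card := Lagrange.degree_interpolate_lt _ hinj
  have hfix : ∀ σ : K ≃ₐ[ℚ] K, P.map (σ : K →+* K) = P := by
    intro σ
    refine Lagrange.eq_interpolate_of_eval_eq (fun x : Fin n → K => x i) hinj ?_ ?_
    · rw [degree_map]; exact hPd
    · intro x hx
      have hy : (fun i => σ.symm (x i)) ∈ s := by
        rw [hs] at hx ⊢
        intro j
        have := hmap K σ.symm.toAlgHom x (MvPolynomial.pderiv j f)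
        rw [hx j, map_zero] at this
        exact this
      have h1 := hPe _ hy
      have h2 : σ (P.eval (σ.symm (x 0))) = x i := by rw [h1]; simp
      have h3 := Polynomial.eval_map_apply (f := (σ : K →+* K)) (p := P) (σ.symm (x 0))
      simp only [RingHom.coe_coe, AlgEquiv.apply_symm_apply] at h3
      rw [h3]; exact h2
  have hlift : ∀ k, ∃ r : ℚ, algebraMap ℚ K r = P.coeff k := by
    intro k
    have := (InfiniteGalois.mem_range_algebraMap_iff_fixed (k := ℚ) (K := K) (P.coeff k)).2 (by
      intro σ
      have := congrArg (fun p => coeff p k) (hfix σ)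
      simpa [coeff_map] using this)
    exact this
  have : P ∈ Polynomial.lifts (algebraMap ℚ K) := by
    rw [Polynomial.lifts_iff_coeff_lifts]
    exact hlift
  obtain ⟨v, hv⟩ := (Polynomial.mem_lifts _).1 this
  refine ⟨v, ?_⟩
  rw [← hrad.radical, ← MvPolynomial.vanishingIdeal_zeroLocus_eq_radical (K := K),
    MvPolynomial.mem_vanishingIdeal_iff, MvPolynomial.zeroLocus_span]
  intro x hx
  have hxs : x ∈ s := by
    rw [hs]; intro j; exact hx _ ⟨j, rfl⟩
  rw [map_sub, MvPolynomial.aeval_X, ← Polynomial.aeval_algHom_apply, MvPolynomial.aeval_X,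
    ← Polynomial.eval_map_algebraMap, hv, hPe x hxs, sub_self]

theorem exists_closure (k : Type) [Field k] :
    ∃ (K : Type) (_ : Field K) (_ : Algebra k K), IsAlgClosure k K :=
  ⟨AlgebraicClosure k, inferInstance, inferInstance, inferInstance⟩

theorem descend' {n : ℕ} [NeZero n] (f : MvPolynomial (Fin n) ℚ)
    (hfin : {x : Fin n → ℂ | ∀ i, MvPolynomial.aeval x (MvPolynomial.pderiv i f) = 0}.Finite)
    (hrad : (Ideal.span (Set.range fun i => MvPolynomial.pderiv i f)).IsRadical)
    (hdist : ∀ x ∈ {x : Fin n → ℂ | ∀ i, MvPolynomial.aeval x (MvPolynomial.pderiv i f) = 0},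
      ∀ y ∈ {x : Fin n → ℂ | ∀ i, MvPolynomial.aeval x (MvPolynomial.pderiv i f) = 0},
      x 0 = y 0 → x = y) (i : Fin n) :
    ∃ v : ℚ[X], MvPolynomial.X i - Polynomial.aeval (MvPolynomial.X (0 : Fin n)) v ∈
      Ideal.span (Set.range fun i => MvPolynomial.pderiv i f) := by
  obtain ⟨K, _, _, hK⟩ := exists_closure ℚ
  have := hK.isAlgClosed
  have := hK.isAlgebraic
  have : IsGalois ℚ K := IsAlgClosure.isGalois ℚ K
  exact descend K f hfin hrad hdist i

end SosAux
open SosAux in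
theorem sos_mod_gradient_shape (n : ℕ) [NeZero n] (f : MvPolynomial (Fin n) ℚ)
    (hf : ∀ x : Fin n → ℝ, 0 ≤ MvPolynomial.aeval x f)
    (hfin : {x : Fin n → ℂ | ∀ i, MvPolynomial.aeval x (MvPolynomial.pderiv i f) = 0}.Finite)
    (hrad : (Ideal.span (Set.range fun i => MvPolynomial.pderiv i f)).IsRadical)
    (hdist : ∀ x ∈ {x : Fin n → ℂ | ∀ i, MvPolynomial.aeval x (MvPolynomial.pderiv i f) = 0},
      ∀ y ∈ {x : Fin n → ℂ | ∀ i, MvPolynomial.aeval x (MvPolynomial.pderiv i f) = 0},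
      x 0 = y 0 → x = y) :
    ∃ (w : Polynomial ℚ) (v : Fin n → Polynomial ℚ) (s : ℕ) (q : Fin s → Polynomial ℚ)
      (c : Fin s → ℚ) (φ : Fin n → MvPolynomial (Fin n) ℚ),
      (∀ j, 0 < c j) ∧
      Ideal.span (Set.range fun i => MvPolynomial.pderiv i f) =
        Ideal.span ({Polynomial.aeval (MvPolynomial.X (0 : Fin n)) w} ∪
          {p | ∃ i : Fin n, i ≠ 0 ∧
            p = MvPolynomial.X i - Polynomial.aeval (MvPolynomial.X (0 : Fin n)) (v i)}) ∧
      f = (∑ j, MvPolynomial.C (c j) * (Polynomial.aeval (MvPolynomial.X (0 : Fin n)) (q j)) ^ 2)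
        + ∑ i ∈ Finset.univ \ {(0 : Fin n)},
            φ i * (MvPolynomial.X i - Polynomial.aeval (MvPolynomial.X (0 : Fin n)) (v i)) := by
  classical
  choose v0 hv0 using descend' f hfin hrad hdist
  set I := Ideal.span (Set.range fun i => MvPolynomial.pderiv i f) with hI
  let v : Fin n → Polynomial ℚ := fun i => if i = 0 then Polynomial.X else v0 i
  have hv00 : v 0 = Polynomial.X := if_pos rfl
  let E : Polynomial ℚ →ₐ[ℚ] MvPolynomial (Fin n) ℚ := Polynomial.aeval (MvPolynomial.X (0 : Fin n))
  have hv : ∀ i, MvPolynomial.X i - E (v i) ∈ I := by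
    intro i
    by_cases hi : i = 0
    · subst hi
      rw [hv00]; simp [E]
    · simp only [v, if_neg hi]; exact hv0 i
  let θ : MvPolynomial (Fin n) ℚ →ₐ[ℚ] Polynomial ℚ := MvPolynomial.aeval v
  let g : Fin n → MvPolynomial (Fin n) ℚ := fun i => MvPolynomial.X i - E (v i)
  let J := Ideal.span (g '' (Finset.univ \ {(0 : Fin n)} : Finset (Fin n)))
  have hθ : ∀ p, p - E (θ p) ∈ J := by
    intro p
    rw [← Ideal.Quotient.mk_eq_mk_iff_sub_mem]
    have : (Ideal.Quotient.mkₐ ℚ J) = ((Ideal.Quotient.mkₐ ℚ J).comp E).comp θ := by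
      apply MvPolynomial.algHom_ext
      intro i
      simp only [AlgHom.comp_apply, θ, MvPolynomial.aeval_X, Ideal.Quotient.mkₐ_eq_mk]
      rw [Ideal.Quotient.mk_eq_mk_iff_sub_mem]
      by_cases hi : i = 0
      · subst hi; rw [hv00]; simp [E]
      · exact Ideal.subset_span ⟨i, by simpa using hi, rfl⟩
    exact congrArg (fun F => F p) this
  have hJI : J ≤ I := by
    refine Ideal.span_le.2 ?_
    rintro _ ⟨i, -, rfl⟩
    exact hv i
  let Q : Ideal (Polynomial ℚ) := I.comap E
  obtain ⟨w, hw⟩ : ∃ w, Q = Ideal.span {w} := (IsPrincipalIdealRing.principal Q).principal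
  have hwQ : E w ∈ I := by
    have : w ∈ Q := by rw [hw]; exact Ideal.mem_span_singleton_self w
    exact this
  have hnn : ∀ x : ℝ, 0 ≤ Polynomial.aeval x (θ f) := by
    intro x
    have : (Polynomial.aeval x).comp θ =
        (MvPolynomial.aeval (fun i => Polynomial.aeval x (v i)) : _ →ₐ[ℚ] ℝ) := by
      apply MvPolynomial.algHom_ext; intro i; simp [θ]
    have h2 := congrArg (fun F => F f) this
    simp only [AlgHom.comp_apply] at h2
    rw [h2]; exact hf _
  obtain ⟨s, q, hq⟩ := sumsq_fin (rat_sumsq _ (θ f) le_rfl hnn)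
  have hfJ := hθ f
  obtain ⟨φ, hφ⟩ : ∃ φ : Fin n → MvPolynomial (Fin n) ℚ,
      ∑ i ∈ Finset.univ \ {(0 : Fin n)}, φ i * g i = f - E (θ f) := by
    obtain ⟨φ, hφ⟩ := (Submodule.mem_span_image_finset_iff_exists_fun (R := MvPolynomial (Fin n) ℚ)).1 hfJ
    refine ⟨fun i => if h : i ∈ Finset.univ \ {(0 : Fin n)} then φ ⟨i, h⟩ else 0, ?_⟩
    rw [← hφ, ← Finset.sum_coe_sort]
    refine Finset.sum_congr rfl fun i _ => ?_
    simp only [dif_pos i.2, smul_eq_mul]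
  refine ⟨w, v, s, q, fun _ => 1, φ, fun _ => one_pos, ?_, ?_⟩
  · apply le_antisymm
    · intro p hp
      have h1 : θ p ∈ Q := by
        have h3 : p - (p - E (θ p)) ∈ I := I.sub_mem hp (hJI (hθ p))
        rw [sub_sub_cancel] at h3
        exact h3
      rw [hw, Ideal.mem_span_singleton] at h1
      obtain ⟨r, hr⟩ := h1
      rw [← sub_add_cancel p (E (θ p))]
      refine Ideal.add_mem _ ?_ ?_
      · refine (Ideal.span_le.2 ?_ : J ≤ _) (hθ p)
        rintro _ ⟨i, hi, rfl⟩
        exact Ideal.subset_span (Or.inr ⟨i, by simpa using hi, rfl⟩)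
      · rw [hr, map_mul]
        exact Ideal.mul_mem_right _ _ (Ideal.subset_span (Or.inl rfl))
    · refine Ideal.span_le.2 ?_
      rintro _ (rfl | ⟨i, -, rfl⟩)
      · exact hwQ
      · exact hv i
  · have h1 : E (θ f) = ∑ j, MvPolynomial.C 1 * (E (q j)) ^ 2 := by
      rw [hq]; simp
    change f = (∑ j, MvPolynomial.C 1 * (E (q j)) ^ 2) + ∑ i ∈ Finset.univ \ {(0 : Fin n)}, φ i * g i
    rw [hφ, ← h1]; ring
end
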